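/- Let V be a Jordan triple system in which orthogonality is symmetric, let w ∈ V be a maximal tripotent, and let u₁, u₂ ∈ V be tripotents with D(w,w)u₁ = u₁/2 and D(w,w)u₂ = u₂/2. If u₁ ≤ u₂ (u₂ − u₁ is a tripotent orthogonal to u₁), then w_{u₁} ≤ w_{u₂} (w_{u₂} − w_{u₁} is a tripotent orthogonal to w_{u₁}) and w_{u₂−u₁} = w_{u₂} − w_{u₁}, where w_u = 2{u,u,w}. -/

import Mathlib

/-- A Jordan triple system: a complex vector space with a triple product
symmetric and linear in the outer variables, conjugate-linear in the middle
variable, satisfying the Jordan triple (main) identity. -/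
structure JordanTriple (V : Type*) [AddCommGroup V] [Module ℂ V] where
  tp : V → V → V → V
  symm_outer : ∀ a b c, tp a b c = tp c b a
  add_fst : ∀ a a' b c, tp (a + a') b c = tp a b c + tp a' b c
  smul_fst : ∀ (r : ℂ) (a b c : V), tp (r • a) b c = r • tp a b c
  add_snd : ∀ a b b' c, tp a (b + b') c = tp a b c + tp a b' c
  smul_snd : ∀ (r : ℂ) (a b c : V), tp a (r • b) c = (starRingEnd ℂ r) • tp a b c
  jordan_identity : ∀ a b x y z,
    tp a b (tp x y z) = tp (tp a b x) y z - tp x (tp b a y) z + tp x y (tp a b z)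

namespace JordanTriple

variable {V : Type*} [AddCommGroup V] [Module ℂ V]

/-- A tripotent: `{e,e,e} = e`. -/
def IsTripotent (T : JordanTriple V) (e : V) : Prop := T.tp e e e = e

/-- Orthogonality of elements: `D(x,y) = 0` and `D(y,x) = 0`. -/
def Orthogonal (T : JordanTriple V) (x y : V) : Prop :=
  (∀ z, T.tp x y z = 0) ∧ (∀ z, T.tp y x z = 0)

/-- A maximal (complete) tripotent: the Peirce projection
`P₀(w) = I - 2 D(w,w) + Q(w)²` vanishes on `V`. -/
def IsMaximalTripotent (T : JordanTriple V) (w : V) : Prop :=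
  T.IsTripotent w ∧ ∀ z : V, z - (2 : ℂ) • T.tp w w z + T.tp w (T.tp w z w) w = 0

/-- Orthogonality is symmetric: `D(a,a)b = 0` implies `D(b,b)a = 0`
(true in every JB*-triple). -/
def OrthSymm (T : JordanTriple V) : Prop :=
  ∀ a b : V, T.tp a a b = 0 → T.tp b b a = 0

end JordanTriple

variable {V : Type*} [AddCommGroup V] [Module ℂ V]

open JordanTriple

namespace JordanTriple

variable {V : Type*} [AddCommGroup V] [Module ℂ V] (T : JordanTriple V)

theorem add_trd (a b c c' : V) : T.tp a b (c + c') = T.tp a b c + T.tp a b c' := by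
  rw [T.symm_outer, T.add_fst, T.symm_outer c, T.symm_outer c']

theorem smul_trd (r : ℂ) (a b c : V) : T.tp a b (r • c) = r • T.tp a b c := by
  rw [T.symm_outer, T.smul_fst, T.symm_outer c]

theorem zero_fst (b c : V) : T.tp 0 b c = 0 := by
  simpa using T.smul_fst 0 0 b c

theorem zero_snd (a c : V) : T.tp a 0 c = 0 := by
  simpa using T.smul_snd 0 a 0 c

theorem zero_trd (a b : V) : T.tp a b 0 = 0 := by
  simpa using T.smul_trd 0 a b 0

theorem neg_fst (a b c : V) : T.tp (-a) b c = -T.tp a b c := by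
  simpa using T.smul_fst (-1) a b c

theorem neg_snd (a b c : V) : T.tp a (-b) c = -T.tp a b c := by
  simpa using T.smul_snd (-1) a b c

theorem neg_trd (a b c : V) : T.tp a b (-c) = -T.tp a b c := by
  simpa using T.smul_trd (-1) a b c

theorem sub_fst (a a' b c : V) : T.tp (a - a') b c = T.tp a b c - T.tp a' b c := by
  simp only [sub_eq_add_neg, add_fst, neg_fst]

theorem sub_snd (a b b' c : V) : T.tp a (b - b') c = T.tp a b c - T.tp a b' c := by
  simp only [sub_eq_add_neg, add_snd, neg_snd]

theorem sub_trd (a b c c' : V) : T.tp a b (c - c') = T.tp a b c - T.tp a b c' := by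
  simp only [sub_eq_add_neg, add_trd, neg_trd]

theorem smul_half_snd (a b c : V) :
    T.tp a ((1 / 2 : ℂ) • b) c = (1 / 2 : ℂ) • T.tp a b c := by
  rw [T.smul_snd, map_div₀, map_one, map_ofNat]

variable {T}

/-- For a tripotent `e`, one has `Q(e)² = 2 D(e,e)² - D(e,e)`. -/
theorem IsTripotent.quad_quad {e : V} (he : T.IsTripotent e) (x : V) :
    T.tp e (T.tp e x e) e = (2 : ℂ) • T.tp e e (T.tp e e x) - T.tp e e x := by
  have h := T.jordan_identity x e e e e
  rw [show T.tp e e e = e from he, T.symm_outer x e e,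
    T.symm_outer (T.tp e e x) e e] at h
  linear_combination (norm := module) h

theorem IsTripotent.quad_eq_zero {e x : V} (he : T.IsTripotent e) (hx : T.tp e e x = 0) :
    T.tp e x e = 0 := by
  have hq := he.quad_quad x
  have hy := T.jordan_identity e e e x e
  rw [show T.tp e e e = e from he, hx, T.zero_snd] at hy
  have hqy := he.quad_quad (T.tp e x e)
  rw [hq, hx, T.zero_trd, smul_zero, sub_zero, T.zero_snd, hy] at hqy
  simp only [sub_zero, T.add_trd, hy] at hqy
  linear_combination (norm := module) -(1 / 6 : ℂ) • hqy

/-- An element of the Peirce space `V₀(e)` is orthogonal to `e`. -/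
theorem IsTripotent.orthogonal {e x : V} (he : T.IsTripotent e) (hx : T.tp e e x = 0) :
    T.Orthogonal x e := by
  have hq := he.quad_eq_zero hx
  have he' : T.tp e e e = e := he
  have hx' : T.tp x e e = 0 := by rw [T.symm_outer, hx]
  constructor <;> intro z
  · have h₁ := T.jordan_identity e e x e z
    have h₂ := T.jordan_identity x e e e z
    rw [hx, he', T.zero_fst] at h₁
    rw [hx', hq, T.zero_fst, T.zero_snd] at h₂
    linear_combination (norm := module) h₁ + h₂
  · have h₁ := T.jordan_identity e e e x z
    have h₂ := T.jordan_identity e x e e z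
    rw [hx, he', T.zero_snd] at h₁
    rw [hx', hq, T.zero_fst, T.zero_snd] at h₂
    linear_combination (norm := module) -h₁ - h₂

theorem IsMaximalTripotent.eq_zero {w z : V} (hw : T.IsMaximalTripotent w)
    (hz : T.tp w w z = 0) : z = 0 := by
  have h := hw.2 z
  simpa [hz, hw.1.quad_eq_zero hz, T.zero_snd] using h

section PeirceOne

variable {w u : V}

theorem IsMaximalTripotent.quad_eq_zero_of_peirce_one (hw : T.IsMaximalTripotent w)
    (hp : T.tp w w u = (1 / 2 : ℂ) • u) : T.tp u w u = 0 := by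
  apply hw.eq_zero
  rw [T.jordan_identity, hp, show T.tp w w w = w from hw.1, T.smul_fst, T.smul_trd]
  module

theorem IsMaximalTripotent.tp_tp_of_peirce_one (hw : T.IsMaximalTripotent w)
    (hu : T.IsTripotent u) (hp : T.tp w w u = (1 / 2 : ℂ) • u) :
    T.tp u u ((2 : ℂ) • T.tp u u w) = (1 / 2 : ℂ) • ((2 : ℂ) • T.tp u u w) := by
  have h := hu.quad_quad w
  rw [hw.quad_eq_zero_of_peirce_one hp, T.zero_snd] at h
  rw [T.smul_trd]
  linear_combination (norm := module) -h

/-- If `w = a + b` is a tripotent with `a ∈ V₁(u)`, `b ∈ V₀(u)`, and `u ∈ V₁(w)`, then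
`a` is a tripotent and `b ∈ V₀(a)`. -/
theorem isTripotent_of_peirce_decomposition {a b : V} (hOS : T.OrthSymm)
    (hw : T.IsTripotent (a + b)) (hu : T.IsTripotent u)
    (hp : T.tp (a + b) (a + b) u = (1 / 2 : ℂ) • u)
    (ha : T.tp u u a = (1 / 2 : ℂ) • a) (hb : T.tp u u b = 0) :
    T.IsTripotent a ∧ T.tp a a b = 0 := by
  have hu' : T.tp u u u = u := hu
  obtain ⟨hbu, hub⟩ := hu.orthogonal hb
  have habu : T.tp a b u = 0 := by rw [T.symm_outer, hub]
  have hbbu : T.tp b b u = 0 := by rw [T.symm_outer, hub]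
  have hbau : T.tp b a u = 0 := by
    simp only [T.add_fst, T.add_snd, habu, hbbu, add_zero] at hp
    have h₁ := T.jordan_identity u u a a u
    have h₂ := T.jordan_identity u u b a u
    have h₃ := congrArg (T.tp u u) hp
    simp only [ha, hb, hu', T.smul_fst, T.smul_half_snd, T.zero_fst, T.add_trd,
      T.smul_trd] at h₁ h₂ h₃
    linear_combination (norm := module) (2 : ℂ) • (hp - h₃ + h₁ + h₂)
  have haab : T.tp a a b = 0 := by
    have h₁ := T.jordan_identity u u b a a
    have h₂ := T.jordan_identity b a u u a
    simp only [ha, hb, hbau, habu, T.smul_half_snd, T.zero_fst, T.zero_snd,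
      T.smul_trd] at h₁ h₂
    rw [T.symm_outer]
    linear_combination (norm := module) (2 : ℂ) • (h₁ + h₂)
  have hbba : T.tp b b a = 0 := hOS a b haab
  have hbab : T.tp b a b = 0 := by
    have h := T.jordan_identity u a b u b
    have hau : T.tp a u u = (1 / 2 : ℂ) • a := by rw [T.symm_outer, ha]
    have huab : T.tp u a b = 0 := by rw [T.symm_outer, hbau]
    simp only [hau, huab, hbu, T.smul_half_snd, T.zero_fst, T.zero_trd] at h
    linear_combination (norm := module) (2 : ℂ) • h
  refine ⟨?_, haab⟩
  have hbaa : T.tp b a a = 0 := by rw [T.symm_outer, haab]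
  have habb : T.tp a b b = 0 := by rw [T.symm_outer, hbba]
  have h : T.tp (a + b) (a + b) (a + b) = a + b := hw
  simp only [T.add_fst, T.add_snd, T.add_trd, haab, hbba, hbaa, habb, hbab, add_zero,
    zero_add] at h
  have haaa := T.jordan_identity u u a a a
  have haba := T.jordan_identity u u a b a
  have hbbb := T.jordan_identity u u b b b
  simp only [ha, hb, T.smul_fst, T.smul_half_snd, T.smul_trd, T.zero_fst, T.zero_snd,
    T.zero_trd] at haaa haba hbbb
  have h₁ := congrArg (T.tp u u) h
  simp only [T.add_trd, haaa, haba, hbbb, ha, hb] at h₁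
  have h₂ := congrArg (T.tp u u) h₁
  simp only [T.add_trd, T.sub_trd, T.smul_trd, T.zero_trd, haaa, haba, ha] at h₂
  show T.tp a a a = a
  linear_combination (norm := module) (4 : ℂ) • h₁ - (4 : ℂ) • h₂

/-- If `w` is a maximal tripotent and `u ∈ V₁(w)` a tripotent, then `w_u` is a tripotent
and `w - w_u` lies in `V₀(w_u)`. -/
theorem IsMaximalTripotent.isTripotent_wu (hOS : T.OrthSymm) (hw : T.IsMaximalTripotent w)
    (hu : T.IsTripotent u) (hp : T.tp w w u = (1 / 2 : ℂ) • u) :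
    T.IsTripotent ((2 : ℂ) • T.tp u u w) ∧
      T.tp ((2 : ℂ) • T.tp u u w) ((2 : ℂ) • T.tp u u w) (w - (2 : ℂ) • T.tp u u w) = 0 := by
  have ha := hw.tp_tp_of_peirce_one hu hp
  refine isTripotent_of_peirce_decomposition hOS ?_ hu ?_ ha ?_
  · rw [add_sub_cancel]; exact hw.1
  · rw [add_sub_cancel]; exact hp
  · rw [T.sub_trd, ha]; module

end PeirceOne

end JordanTriple

/-- Assume orthogonality is symmetric.  Let `w` be a maximal tripotent and let
`u₁, u₂` be tripotents in `V₁(w)` with `u₁ ≤ u₂`.  Then `w_{u₁} ≤ w_{u₂}`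
and `w_{u₂-u₁} = w_{u₂} - w_{u₁}`, where `w_u = 2{u,u,w}`. -/
theorem wu_monotone (T : JordanTriple V) (hOS : T.OrthSymm) (w u₁ u₂ : V)
    (hw : T.IsMaximalTripotent w)
    (h1 : T.IsTripotent u₁) (h2 : T.IsTripotent u₂)
    (hp1 : T.tp w w u₁ = (1/2 : ℂ) • u₁)
    (hp2 : T.tp w w u₂ = (1/2 : ℂ) • u₂)
    (h3 : T.IsTripotent (u₂ - u₁)) (h4 : T.Orthogonal (u₂ - u₁) u₁) :
    (T.IsTripotent ((2 : ℂ) • T.tp u₂ u₂ w - (2 : ℂ) • T.tp u₁ u₁ w) ∧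
      T.Orthogonal ((2 : ℂ) • T.tp u₂ u₂ w - (2 : ℂ) • T.tp u₁ u₁ w)
        ((2 : ℂ) • T.tp u₁ u₁ w)) ∧
    (2 : ℂ) • T.tp (u₂ - u₁) (u₂ - u₁) w =
      (2 : ℂ) • T.tp u₂ u₂ w - (2 : ℂ) • T.tp u₁ u₁ w := by
  obtain ⟨v, rfl⟩ : ∃ v, u₂ = u₁ + v := ⟨u₂ - u₁, by abel⟩
  rw [add_sub_cancel_left] at h3 h4 ⊢
  obtain ⟨hvu, huv⟩ := h4
  have hpv : T.tp w w v = (1 / 2 : ℂ) • v := by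
    rw [T.add_trd, hp1] at hp2
    linear_combination (norm := module) hp2
  have hD (z : V) : T.tp (u₁ + v) (u₁ + v) z = T.tp u₁ u₁ z + T.tp v v z := by
    simp only [T.add_fst, T.add_snd, hvu, huv, add_zero, zero_add]
  have hsub : (2 : ℂ) • T.tp v v w =
      (2 : ℂ) • T.tp (u₁ + v) (u₁ + v) w - (2 : ℂ) • T.tp u₁ u₁ w := by
    rw [hD]; module
  rw [← hsub]
  have hcomm : T.tp u₁ u₁ (T.tp v v w) = T.tp v v (T.tp u₁ u₁ w) := by
    have huuv : T.tp u₁ u₁ v = 0 := by rw [T.symm_outer, hvu]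
    rw [T.jordan_identity, huuv, T.zero_fst, T.zero_snd, sub_zero, zero_add]
  have ha := hw.tp_tp_of_peirce_one h1 hp1
  have hc := hw.tp_tp_of_peirce_one h3 hpv
  have hs := hw.tp_tp_of_peirce_one h2 hp2
  obtain ⟨hta, hab⟩ := hw.isTripotent_wu hOS h1 hp1
  have hva : T.tp v v ((2 : ℂ) • T.tp u₁ u₁ w) = 0 := by
    simp only [hD, T.smul_trd, T.add_trd, hcomm] at ha hc hs ⊢
    linear_combination (norm := module) (1 / 2 : ℂ) • (hs - ha - hc)
  refine ⟨⟨(hw.isTripotent_wu hOS h3 hpv).1, hta.orthogonal ?_⟩, rfl⟩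
  generalize (2 : ℂ) • T.tp u₁ u₁ w = a at *
  have haaw : T.tp a a w = a := by
    rw [T.sub_trd, show T.tp a a a = a from hta] at hab
    exact sub_eq_zero.mp hab
  have haav : T.tp a a v = 0 := by
    rw [T.symm_outer, (h3.orthogonal hva).2]
  rw [T.smul_trd, T.jordan_identity, haav, haaw, hva, T.zero_fst, T.zero_snd]
  simp
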